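/- Let (x_j)_{j∈J} be a frame for H with frame bounds 0 < A ≤ B and frame operator S, and fix α with 0 < α < 2/B. Then the operator series α·∑_{n=0}^∞ (I − αS)^n converges in operator norm and its sum equals S⁻¹. -/

import Mathlib

noncomputable section

local notation "⟪" x ", " y "⟫" => @inner ℝ _ _ x y

section Frame

variable {H J : Type*} [NormedAddCommGroup H] [InnerProductSpace ℝ H]

/-- The synthesis operator of a Bessel family is bounded on finitely supported coefficients. -/
theorem norm_sq_sum_smul_le_of_bessel {xj : J → H} {B : ℝ} (hB0 : 0 ≤ B)
    (hB : ∀ (x : H) (F : Finset J), ∑ j ∈ F, ⟪x, xj j⟫ ^ 2 ≤ B * ‖x‖ ^ 2)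
    (c : J → ℝ) (F : Finset J) :
    ‖∑ j ∈ F, c j • xj j‖ ^ 2 ≤ B * ∑ j ∈ F, c j ^ 2 := by
  have hc : 0 ≤ ∑ j ∈ F, c j ^ 2 := Finset.sum_nonneg fun j _ => sq_nonneg _
  set v := ∑ j ∈ F, c j • xj j with hv
  have hself : ‖v‖ ^ 2 = ∑ j ∈ F, c j * ⟪v, xj j⟫ := by
    rw [← real_inner_self_eq_norm_sq]
    nth_rewrite 2 [hv]
    simp only [inner_sum, real_inner_smul_right]
  have hcs : ‖v‖ ^ 2 * ‖v‖ ^ 2 ≤ (B * ∑ j ∈ F, c j ^ 2) * ‖v‖ ^ 2 := by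
    calc ‖v‖ ^ 2 * ‖v‖ ^ 2 = (∑ j ∈ F, c j * ⟪v, xj j⟫) ^ 2 := by rw [← hself]; ring
      _ ≤ (∑ j ∈ F, c j ^ 2) * ∑ j ∈ F, ⟪v, xj j⟫ ^ 2 := Finset.sum_mul_sq_le_sq_mul_sq _ _ _
      _ ≤ (∑ j ∈ F, c j ^ 2) * (B * ‖v‖ ^ 2) := mul_le_mul_of_nonneg_left (hB v F) hc
      _ = (B * ∑ j ∈ F, c j ^ 2) * ‖v‖ ^ 2 := by ring
  rcases (sq_nonneg ‖v‖).eq_or_lt with h | h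
  · rw [← h]
    positivity
  · exact le_of_mul_le_mul_right hcs h

/-- A square-summable combination of a Bessel family converges unconditionally. -/
theorem summable_smul_of_bessel [CompleteSpace H] {xj : J → H} {B : ℝ} (hB0 : 0 < B)
    (hB : ∀ (x : H) (F : Finset J), ∑ j ∈ F, ⟪x, xj j⟫ ^ 2 ≤ B * ‖x‖ ^ 2)
    {c : J → ℝ} (hc : Summable fun j => c j ^ 2) :
    Summable fun j => c j • xj j := by
  rw [summable_iff_vanishing_norm]
  intro ε hε
  obtain ⟨s, hs⟩ := summable_iff_vanishing_norm.mp hc (ε ^ 2 / B) (by positivity)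
  refine ⟨s, fun t ht => lt_of_pow_lt_pow_left₀ 2 hε.le ?_⟩
  calc ‖∑ j ∈ t, c j • xj j‖ ^ 2 ≤ B * ∑ j ∈ t, c j ^ 2 :=
        norm_sq_sum_smul_le_of_bessel hB0.le hB c t
    _ < B * (ε ^ 2 / B) :=
        mul_lt_mul_of_pos_left ((Real.le_norm_self _).trans_lt (hs t ht)) hB0
    _ = ε ^ 2 := by field_simp

/-- A lower frame inequality forces the squared frame coefficients to be summable. -/
theorem summable_sq_inner_of_lower_bound {xj : J → H} {A : ℝ} (hA : 0 < A) {x : H}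
    (hx : A * ‖x‖ ^ 2 ≤ ∑' j, ⟪x, xj j⟫ ^ 2) : Summable fun j => ⟪x, xj j⟫ ^ 2 := by
  by_contra h
  rw [tsum_eq_zero_of_not_summable h] at hx
  have hx0 : x = 0 := by
    by_contra hne
    have := norm_pos_iff.mpr hne
    exact absurd hx (not_le.mpr (by positivity))
  exact h (by simp [hx0])

end Frame

/-- A symmetric operator is bounded in norm by any bound on its quadratic form. -/
theorem LinearMap.IsSymmetric.opNorm_le_of_abs_inner_le {H : Type*} [NormedAddCommGroup H]
    [InnerProductSpace ℝ H] {T : H →L[ℝ] H} (hT : (T : H →ₗ[ℝ] H).IsSymmetric) {q : ℝ}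
    (hq : 0 ≤ q) (h : ∀ x, |⟪T x, x⟫| ≤ q * ‖x‖ ^ 2) : ‖T‖ ≤ q := by
  rw [T.norm_eq_iSup_rayleighQuotient hT]
  refine ciSup_le fun x => ?_
  rw [ContinuousLinearMap.rayleighQuotient, ContinuousLinearMap.reApplyInnerSelf_apply, abs_div,
    abs_of_nonneg (sq_nonneg ‖x‖)]
  exact div_le_of_le_mul₀ (sq_nonneg _) hq (h x)

/-- If `A ≤ S ≤ B` as quadratic forms and `0 < α < 2 / B`, then `1 - α • S` is a strict
contraction. -/
theorem LinearMap.IsSymmetric.norm_one_sub_smul_lt_one {H : Type*} [NormedAddCommGroup H]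
    [InnerProductSpace ℝ H] {S : H →L[ℝ] H} (hS : (S : H →ₗ[ℝ] H).IsSymmetric) {A B α : ℝ}
    (hA : 0 < A) (hAB : A ≤ B) (hlow : ∀ x, A * ‖x‖ ^ 2 ≤ ⟪S x, x⟫)
    (hupp : ∀ x, ⟪S x, x⟫ ≤ B * ‖x‖ ^ 2) (hα0 : 0 < α) (hα2 : α < 2 / B) :
    ‖(1 : H →L[ℝ] H) - α • S‖ < 1 := by
  have hαB : α * B < 2 := (lt_div_iff₀ (hA.trans_le hAB)).mp hα2
  have hαA : 0 < α * A := mul_pos hα0 hA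
  have hq : max (1 - α * A) (α * B - 1) < 1 := max_lt (by linarith) (by linarith)
  have hq0 : 0 ≤ max (1 - α * A) (α * B - 1) := by
    have := mul_le_mul_of_nonneg_left hAB hα0.le
    rcases le_total (α * A) 1 with h | h
    · exact le_max_of_le_left (by linarith)
    · exact le_max_of_le_right (by linarith)
  refine lt_of_le_of_lt (LinearMap.IsSymmetric.opNorm_le_of_abs_inner_le ?_ hq0 fun x => ?_) hq
  · intro x y
    have := hS x y
    simp only [ContinuousLinearMap.coe_coe] at this
    simp [inner_sub_left, inner_sub_right, real_inner_smul_left, real_inner_smul_right, this]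
  · have hform : ⟪((1 : H →L[ℝ] H) - α • S) x, x⟫ = ‖x‖ ^ 2 - α * ⟪S x, x⟫ := by
      simp [inner_sub_left, real_inner_smul_left]
    have hl := mul_le_mul_of_nonneg_left (hlow x) hα0.le
    have hu := mul_le_mul_of_nonneg_left (hupp x) hα0.le
    have h1 := mul_le_mul_of_nonneg_right (le_max_left (1 - α * A) (α * B - 1))
      (sq_nonneg ‖x‖)
    have h2 := mul_le_mul_of_nonneg_right (le_max_right (1 - α * A) (α * B - 1))
      (sq_nonneg ‖x‖)
    rw [hform, abs_le]
    constructor <;> linarith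

/-- Let `(xj j)_{j ∈ J}` be a frame for `H` with bounds `0 < A ≤ B` and frame operator `S`,
and fix `0 < α < 2 / B`.  Then the Neumann series `α • ∑ (I - α • S) ^ n` converges in
operator norm and its sum is the (two-sided) inverse of `S`. -/
theorem frame_operator_neumann_series
    {H : Type*} [NormedAddCommGroup H] [InnerProductSpace ℝ H] [CompleteSpace H]
    {J : Type*} [Countable J] (xj : J → H)
    (A B : ℝ) (hA : 0 < A) (hAB : A ≤ B)
    (hframe : ∀ x : H,
      A * ‖x‖ ^ 2 ≤ ∑' j, ⟪x, xj j⟫ ^ 2 ∧ ∑' j, ⟪x, xj j⟫ ^ 2 ≤ B * ‖x‖ ^ 2)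
    (S : H →L[ℝ] H) (hS : ∀ x : H, S x = ∑' j, ⟪x, xj j⟫ • xj j)
    (α : ℝ) (hα0 : 0 < α) (hα2 : α < 2 / B) :
    Summable (fun n : ℕ => α • ((1 : H →L[ℝ] H) - α • S) ^ n) ∧
      (∑' n : ℕ, α • ((1 : H →L[ℝ] H) - α • S) ^ n) ∘L S = 1 ∧
      S ∘L (∑' n : ℕ, α • ((1 : H →L[ℝ] H) - α • S) ^ n) = 1 := by
  have hB : 0 < B := hA.trans_le hAB
  have hsq : ∀ x, Summable fun j => ⟪x, xj j⟫ ^ 2 := fun x =>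
    summable_sq_inner_of_lower_bound hA (hframe x).1
  have hbessel : ∀ (x : H) (F : Finset J), ∑ j ∈ F, ⟪x, xj j⟫ ^ 2 ≤ B * ‖x‖ ^ 2 := fun x F =>
    ((hsq x).sum_le_tsum F fun j _ => sq_nonneg _).trans (hframe x).2
  have hinner : ∀ x y, ⟪S x, y⟫ = ∑' j, ⟪x, xj j⟫ * ⟪y, xj j⟫ := fun x y => by
    have hsum := (summable_smul_of_bessel hB hbessel (hsq x)).hasSum
    rw [← hS x] at hsum
    have := hsum.mapL (innerSL ℝ y)
    simp only [innerSL_apply_apply, real_inner_smul_right] at this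
    rw [real_inner_comm, this.tsum_eq]
  have hquad : ∀ x, ⟪S x, x⟫ = ∑' j, ⟪x, xj j⟫ ^ 2 := fun x => by
    simp only [hinner, sq]
  have hsymm : (S : H →ₗ[ℝ] H).IsSymmetric := fun x y => by
    simp only [ContinuousLinearMap.coe_coe]
    rw [real_inner_comm (S y) x, hinner, hinner]
    simp only [mul_comm]
  have hlt : ‖(1 : H →L[ℝ] H) - α • S‖ < 1 :=
    hsymm.norm_one_sub_smul_lt_one hA hAB (fun x => (hquad x).symm ▸ (hframe x).1)
      (fun x => (hquad x).symm ▸ (hframe x).2) hα0 hα2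
  have hgeom := summable_geometric_of_norm_lt_one hlt
  refine ⟨hgeom.const_smul α, ?_, ?_⟩
  · have := geom_series_mul_neg _ hlt
    rw [sub_sub_cancel, mul_smul_comm] at this
    rw [hgeom.tsum_const_smul, ← ContinuousLinearMap.mul_def, smul_mul_assoc, this]
  · have := mul_neg_geom_series _ hlt
    rw [sub_sub_cancel, smul_mul_assoc] at this
    rw [hgeom.tsum_const_smul, ← ContinuousLinearMap.mul_def, mul_smul_comm, this]
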